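/- arXiv:1401.4743 — 3 statements merged into one kernel-verified Lean document; each statement's English description precedes it below -/
import Mathlib

section
/- Let L₁, L₂, L₃ be affine lines in the Euclidean plane ℝ², and let p₁, p₂, p₃ : ℝ → ℝ² be continuous maps with pᵢ(t) ∈ Lᵢ for all t and all i ∈ {1,2,3}, such that each pairwise distance dist(pᵢ(t), pⱼ(t)) is constant in t and positive, the points p₁(0), p₂(0), p₃(0) are not collinear, and the motion is nonconstant (there exist i and t with pᵢ(t) ≠ pᵢ(0)). Then either the directions of L₁, L₂, L₃ all coincide (the three lines are pairwise parallel), or there exists a point lying on all three lines (the lines are concurrent). -/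
/-- `L` is an affine line: a nonempty affine subspace whose direction has dimension 1. -/
def IsAffineLine {n : ℕ} (L : AffineSubspace ℝ (EuclideanSpace ℝ (Fin n))) : Prop :=
  (L : Set (EuclideanSpace ℝ (Fin n))).Nonempty ∧ Module.finrank ℝ L.direction = 1

/-- A continuous real function whose square is constant is itself constant. -/
lemma Continuous.eq_of_sq_const {f : ℝ → ℝ} (hf : Continuous f) (h : ∀ t, f t ^ 2 = f 0 ^ 2)
    (t : ℝ) : f t = f 0 := by
  by_cases h0 : f 0 = 0
  · have := h t
    rw [h0] at this ⊢
    simpa using this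
  · exact isPreconnected_univ.eq_of_sq_eq (g := fun _ => f 0) hf.continuousOn
      continuousOn_const (fun s _ => h s) (fun _ => h0) (Set.mem_univ 0) rfl (Set.mem_univ t)

/-- A planar vector of constant length, moving continuously on a line missing the origin,
does not move. -/
lemma const_of_linear_of_norm_sq {u v : ℝ → ℝ} (hu : Continuous u) (hv : Continuous v)
    {a b k : ℝ} (hk : k ≠ 0) (hlin : ∀ t, a * u t + b * v t = k)
    (hnorm : ∀ t, u t ^ 2 + v t ^ 2 = u 0 ^ 2 + v 0 ^ 2) (t : ℝ) :
    u t = u 0 ∧ v t = v 0 := by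
  have hdet : a * v t - b * u t = a * v 0 - b * u 0 := by
    refine Continuous.eq_of_sq_const (f := fun t => a * v t - b * u t) (by fun_prop) ?_ t
    intro s
    linear_combination (a ^ 2 + b ^ 2) * hnorm s
      - (a * u s + b * v s + (a * u 0 + b * v 0)) * (hlin s - hlin 0)
  have hab : a ^ 2 + b ^ 2 ≠ 0 := by
    intro h
    have ha : a = 0 := by nlinarith [sq_nonneg a, sq_nonneg b]
    have hb : b = 0 := by nlinarith [sq_nonneg a, sq_nonneg b]
    apply hk
    simpa [ha, hb] using (hlin 0).symm
  constructor <;> apply mul_left_cancel₀ hab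
  · linear_combination a * (hlin t - hlin 0) - b * hdet
  · linear_combination b * (hlin t - hlin 0) + a * hdet

/-- Coordinate form: if a rigid triangle moves with its vertices on the lines
`A * x + B * y = c`, the first two of which intersect, then either the lines satisfy the
concurrency relation or the triangle does not move. -/
lemma concurrent_or_const {x₁ y₁ x₂ y₂ x₃ y₃ : ℝ → ℝ}
    (hx₁ : Continuous x₁) (hy₁ : Continuous y₁) (hx₂ : Continuous x₂) (hy₂ : Continuous y₂)
    (hx₃ : Continuous x₃) (hy₃ : Continuous y₃) {A₁ B₁ c₁ A₂ B₂ c₂ A₃ B₃ c₃ : ℝ}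
    (h₁ : ∀ t, A₁ * x₁ t + B₁ * y₁ t = c₁) (h₂ : ∀ t, A₂ * x₂ t + B₂ * y₂ t = c₂)
    (h₃ : ∀ t, A₃ * x₃ t + B₃ * y₃ t = c₃)
    (h₁₂ : ∀ t, (x₂ t - x₁ t) ^ 2 + (y₂ t - y₁ t) ^ 2 = (x₂ 0 - x₁ 0) ^ 2 + (y₂ 0 - y₁ 0) ^ 2)
    (h₁₃ : ∀ t, (x₃ t - x₁ t) ^ 2 + (y₃ t - y₁ t) ^ 2 = (x₃ 0 - x₁ 0) ^ 2 + (y₃ 0 - y₁ 0) ^ 2)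
    (h₂₃ : ∀ t, (x₃ t - x₂ t) ^ 2 + (y₃ t - y₂ t) ^ 2 = (x₃ 0 - x₂ 0) ^ 2 + (y₃ 0 - y₂ 0) ^ 2)
    (hne : (x₂ 0 - x₁ 0) ^ 2 + (y₂ 0 - y₁ 0) ^ 2 ≠ 0) (hD : A₁ * B₂ - A₂ * B₁ ≠ 0) :
    (A₁ * B₂ - A₂ * B₁) * c₃ + (A₂ * B₃ - A₃ * B₂) * c₁ + (A₃ * B₁ - A₁ * B₃) * c₂ = 0 ∨
      ∀ t, (x₁ t = x₁ 0 ∧ y₁ t = y₁ 0) ∧ (x₂ t = x₂ 0 ∧ y₂ t = y₂ 0) ∧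
        (x₃ t = x₃ 0 ∧ y₃ t = y₃ 0) := by
  refine or_iff_not_imp_left.2 fun hk t => ?_
  set r := (x₂ 0 - x₁ 0) ^ 2 + (y₂ 0 - y₁ 0) ^ 2 with hr
  obtain ⟨a, ha⟩ : ∃ a, a = (x₂ 0 - x₁ 0) * (x₃ 0 - x₁ 0) + (y₂ 0 - y₁ 0) * (y₃ 0 - y₁ 0) :=
    ⟨_, rfl⟩
  obtain ⟨b, hb⟩ : ∃ b, b = (x₂ 0 - x₁ 0) * (y₃ 0 - y₁ 0) - (y₂ 0 - y₁ 0) * (x₃ 0 - x₁ 0) :=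
    ⟨_, rfl⟩
  have hinner : ∀ t, (x₂ t - x₁ t) * (x₃ t - x₁ t) + (y₂ t - y₁ t) * (y₃ t - y₁ t) = a := by
    intro t
    linear_combination (h₁₂ t + h₁₃ t - h₂₃ t) / 2 - ha + hr / 2
  have hdet : ∀ t, (x₂ t - x₁ t) * (y₃ t - y₁ t) - (y₂ t - y₁ t) * (x₃ t - x₁ t) = b := by
    intro t
    rw [hb]
    refine Continuous.eq_of_sq_const (f := fun t =>
      (x₂ t - x₁ t) * (y₃ t - y₁ t) - (y₂ t - y₁ t) * (x₃ t - x₁ t)) (by fun_prop) ?_ t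
    intro s
    have e := congrArg₂ (· * ·) (h₁₂ s) (h₁₃ s)
    have i := congrArg (· ^ 2) ((hinner s).trans (hinner 0).symm)
    rw [hr] at e
    linear_combination e - i
  have hX : ∀ t, r * (x₃ t - x₁ t) = a * (x₂ t - x₁ t) - b * (y₂ t - y₁ t) := by
    intro t
    rw [← h₁₂ t, ← hinner t, ← hdet t]
    ring
  have hY : ∀ t, r * (y₃ t - y₁ t) = a * (y₂ t - y₁ t) + b * (x₂ t - x₁ t) := by
    intro t
    rw [← h₁₂ t, ← hinner t, ← hdet t]
    ring
  obtain ⟨hu, hv⟩ := const_of_linear_of_norm_sq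
    (u := fun t => x₂ t - x₁ t) (v := fun t => y₂ t - y₁ t)
    (a := r * (A₃ * B₁ - A₁ * B₃) * A₂ + (A₁ * B₂ - A₂ * B₁) * (A₃ * a + B₃ * b))
    (b := r * (A₃ * B₁ - A₁ * B₃) * B₂ + (A₁ * B₂ - A₂ * B₁) * (B₃ * a - A₃ * b))
    (by fun_prop) (by fun_prop) (mul_ne_zero hne hk)
    (fun t => by
      linear_combination r * (A₁ * B₂ - A₂ * B₁) * h₃ t + r * (A₂ * B₃ - A₃ * B₂) * h₁ t
        + r * (A₃ * B₁ - A₁ * B₃) * h₂ t - (A₁ * B₂ - A₂ * B₁) * (A₃ * hX t + B₃ * hY t))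
    h₁₂ t
  have hx : x₁ t = x₁ 0 := by
    apply mul_left_cancel₀ hD
    linear_combination B₂ * (h₁ t - h₁ 0) - B₁ * (h₂ t - h₂ 0) + B₁ * (A₂ * hu + B₂ * hv)
  have hy : y₁ t = y₁ 0 := by
    apply mul_left_cancel₀ hD
    linear_combination A₁ * (h₂ t - h₂ 0) - A₂ * (h₁ t - h₁ 0) - A₁ * (A₂ * hu + B₂ * hv)
  refine ⟨⟨hx, hy⟩, ⟨by linarith, by linarith⟩, ?_, ?_⟩ <;> apply mul_left_cancel₀ hne
  · linear_combination hX t - hX 0 + r * hx + a * hu - b * hv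
  · linear_combination hY t - hY 0 + r * hy + a * hv + b * hu

/-- An affine line in the plane has a linear equation, whose coefficients determine its
direction. -/
lemma IsAffineLine.exists_equation {L : AffineSubspace ℝ (EuclideanSpace ℝ (Fin 2))}
    (hL : IsAffineLine L) : ∃ A B c : ℝ,
      (∀ q, q ∈ L ↔ A * q 0 + B * q 1 = c) ∧
      (A ≠ 0 ∨ B ≠ 0) ∧ ∀ v, v ∈ L.direction ↔ A * v 0 + B * v 1 = 0 := by
  obtain ⟨⟨p, hp⟩, hdim⟩ := hL
  obtain ⟨⟨d, hd⟩, hd0, hspan⟩ := finrank_eq_one_iff'.1 hdim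
  have hne : -d 1 ≠ 0 ∨ d 0 ≠ 0 := by
    by_contra! h
    apply hd0
    ext i
    fin_cases i
    · simpa using h.2
    · simpa using h.1
  have hdir : ∀ v, v ∈ L.direction ↔ -d 1 * v 0 + d 0 * v 1 = 0 := by
    intro v
    constructor
    · intro hv
      obtain ⟨s, hs⟩ := hspan ⟨v, hv⟩
      obtain rfl : s • d = v := congrArg Subtype.val hs
      simp only [PiLp.smul_apply, smul_eq_mul]
      ring
    · intro h
      rcases hne with h1 | h0
      · have h1' : d 1 ≠ 0 := by simpa using h1
        have : v = (v 1 / d 1) • d := by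
          ext i
          fin_cases i <;> simp <;> field_simp
          linarith
        rw [this]
        exact L.direction.smul_mem _ hd
      · have : v = (v 0 / d 0) • d := by
          ext i
          fin_cases i <;> simp <;> field_simp
          linarith
        rw [this]
        exact L.direction.smul_mem _ hd
  refine ⟨-d 1, d 0, -d 1 * p 0 + d 0 * p 1, fun q => ?_, hne, hdir⟩
  rw [← AffineSubspace.vsub_right_mem_direction_iff_mem hp, hdir]
  simp only [vsub_eq_sub, PiLp.sub_apply]
  constructor <;> intro h <;> linarith

theorem straight_line_motion_plane
    (L : Fin 3 → AffineSubspace ℝ (EuclideanSpace ℝ (Fin 2)))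
    (hL : ∀ i, IsAffineLine (L i))
    (p : Fin 3 → ℝ → EuclideanSpace ℝ (Fin 2))
    (hcont : ∀ i, Continuous (p i))
    (hmem : ∀ i t, p i t ∈ L i)
    (hrigid : ∀ i j t, dist (p i t) (p j t) = dist (p i 0) (p j 0))
    (hpos : ∀ i j, i ≠ j → 0 < dist (p i 0) (p j 0))
    (hncol : ¬ Collinear ℝ ({p 0 0, p 1 0, p 2 0} : Set (EuclideanSpace ℝ (Fin 2))))
    (hmove : ∃ i t, p i t ≠ p i 0) :
    (∀ i j, (L i).direction = (L j).direction) ∨ (∃ q, ∀ i, q ∈ L i) := by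
  choose A B c hmemL hAB hdir using fun i => (hL i).exists_equation
  refine or_iff_not_imp_left.2 fun hpar => ?_
  obtain ⟨i, j, hD⟩ : ∃ i j, A i * B j - A j * B i ≠ 0 := by
    by_contra! h
    refine hpar fun i j => ?_
    ext v
    rw [hdir, hdir]
    have hij := h i j
    constructor <;> intro hv
    · rcases hAB i with h0 | h0 <;> apply mul_left_cancel₀ h0
      · linear_combination A j * hv + v 1 * hij
      · linear_combination B j * hv - v 0 * hij
    · rcases hAB j with h0 | h0 <;> apply mul_left_cancel₀ h0
      · linear_combination A i * hv - v 1 * hij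
      · linear_combination B i * hv + v 0 * hij
  have hij : i ≠ j := by
    rintro rfl
    exact hD (by ring)
  obtain ⟨k, hk⟩ : ∃ k : Fin 3, ∀ l, l = i ∨ l = j ∨ l = k := by
    clear hD
    revert i j
    decide
  have hsq : ∀ i j t, (p j t 0 - p i t 0) ^ 2 + (p j t 1 - p i t 1) ^ 2
      = dist (p j t) (p i t) ^ 2 := by
    intro i j t
    rw [EuclideanSpace.dist_eq, Real.sq_sqrt (by positivity)]
    simp [Fin.sum_univ_two, Real.dist_eq, sq_abs]
  have hrig : ∀ i j t, (p j t 0 - p i t 0) ^ 2 + (p j t 1 - p i t 1) ^ 2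
      = (p j 0 0 - p i 0 0) ^ 2 + (p j 0 1 - p i 0 1) ^ 2 := by
    intro i j t
    rw [hsq, hsq, hrigid]
  have hcoord : ∀ i l, Continuous fun t => p i t l := by
    intro i l
    have := hcont i
    fun_prop
  have heq : ∀ i t, A i * p i t 0 + B i * p i t 1 = c i := fun i t => (hmemL i _).1 (hmem i t)
  rcases concurrent_or_const (hcoord i 0) (hcoord i 1) (hcoord j 0) (hcoord j 1) (hcoord k 0)
    (hcoord k 1) (heq i) (heq j) (heq k) (hrig i j) (hrig i k) (hrig j k)
    (by rw [hsq]; exact (pow_pos (hpos j i hij.symm) 2).ne') hD with h | h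
  · refine ⟨!₂[(c i * B j - c j * B i) / (A i * B j - A j * B i),
      (A i * c j - A j * c i) / (A i * B j - A j * B i)], fun l => (hmemL l _).2 ?_⟩
    simp only [Matrix.cons_val_zero, Matrix.cons_val_one]
    rw [mul_div_assoc', mul_div_assoc', ← add_div, div_eq_iff hD]
    rcases hk l with rfl | rfl | rfl
    · ring
    · ring
    · linear_combination -h
  · exfalso
    obtain ⟨l, t, hne⟩ := hmove
    obtain ⟨hi, hj, hk'⟩ := h t
    apply hne
    ext n
    rcases hk l with rfl | rfl | rfl <;> fin_cases n
    exacts [hi.1, hi.2, hj.1, hj.2, hk'.1, hk'.2]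
end

section
/- Let k ≥ 3, let L₁, …, L_k be affine lines in the Euclidean plane ℝ², and let p₁, …, p_k : ℝ → ℝ² be continuous maps with pᵢ(t) ∈ Lᵢ for all t and all i, such that every pairwise distance dist(pᵢ(t), pⱼ(t)) is constant in t, the points p₁(0), …, p_k(0) are not all collinear, and the motion is nonconstant (there exist i and t with pᵢ(t) ≠ pᵢ(0)). Then either the directions of L₁, …, L_k all coincide (the lines are pairwise parallel), or for every t the points p₁(t), …, p_k(t) all lie on a common circle. -/
/-- A continuous real function whose square is constant is constant. -/
theorem Continuous.eq_of_sq_eq {f : ℝ → ℝ} (hf : Continuous f)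
    (h : ∀ s t, f s ^ 2 = f t ^ 2) (s t : ℝ) : f s = f t := by
  by_contra hne
  have hinf := (isPreconnected_range hf).infinite_of_nontrivial
    ⟨f s, ⟨s, rfl⟩, f t, ⟨t, rfl⟩, hne⟩
  refine hinf ((Set.toFinite {f s, -f s}).subset ?_)
  rintro _ ⟨r, rfl⟩
  exact sq_eq_sq_iff_eq_or_eq_neg.mp (h r s)

open ComplexConjugate in
/-- For two continuously moving complex numbers at constant mutual distance and of constant
modulus, the product of one with the conjugate of the other is constant. -/
theorem Complex.mul_conj_eq_of_norm_eq {u w : ℝ → ℂ} (hu : Continuous u) (hw : Continuous w)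
    (hun : ∀ t, ‖u t‖ = ‖u 0‖) (hwn : ∀ t, ‖w t‖ = ‖w 0‖)
    (hd : ∀ t, ‖w t - u t‖ = ‖w 0 - u 0‖) (t : ℝ) :
    w t * conj (u t) = w 0 * conj (u 0) := by
  have hu' (t) : normSq (u t) = normSq (u 0) := by simp only [normSq_eq_norm_sq, hun t]
  have hw' (t) : normSq (w t) = normSq (w 0) := by simp only [normSq_eq_norm_sq, hwn t]
  have hd' (t) : normSq (w t - u t) = normSq (w 0 - u 0) := by
    simp only [normSq_eq_norm_sq, hd t]
  have hre (t) : (w t * conj (u t)).re = (w 0 * conj (u 0)).re := by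
    have := hd' t
    rw [normSq_sub, normSq_sub, hu' t, hw' t] at this
    linarith
  have him (t) : (w t * conj (u t)).im ^ 2 = (w 0 * conj (u 0)).im ^ 2 := by
    have h : normSq (w t * conj (u t)) = normSq (w 0 * conj (u 0)) := by
      simp only [normSq_mul, normSq_conj, hu' t, hw' t]
    rw [normSq_apply, normSq_apply, hre t] at h
    linarith
  refine Complex.ext (hre t) (Continuous.eq_of_sq_eq
    (f := fun t => (w t * conj (u t)).im) ?_ (fun s t => ?_) t 0)
  · exact continuous_im.comp (hw.mul (continuous_conj.comp hu))
  · exact (him s).trans (him t).symm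

open ComplexConjugate in
/-- A continuous rigid motion of a planar configuration with two distinct points is given by
rotations followed by translations. -/
theorem Complex.exists_rotation_of_dist_eq {ι : Type*} {P : ι → ℝ → ℂ}
    (hcont : ∀ i, Continuous (P i))
    (hrigid : ∀ i j t, dist (P i t) (P j t) = dist (P i 0) (P j 0))
    {i j : ι} (hij : P i 0 ≠ P j 0) :
    ∃ z : ℝ → ℂ, Continuous z ∧ z 0 = 1 ∧ (∀ t, ‖z t‖ = 1) ∧
      ∀ m t, P m t = P i t + (P m 0 - P i 0) * z t := by
  have hu0 : P j 0 - P i 0 ≠ 0 := sub_ne_zero.mpr hij.symm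
  have hnorm (m n t) : ‖P m t - P n t‖ = ‖P m 0 - P n 0‖ := by
    simpa only [dist_eq_norm] using hrigid m n t
  refine ⟨fun t => (P j t - P i t) / (P j 0 - P i 0),
    ((hcont j).sub (hcont i)).div_const _, div_self hu0, fun t => ?_, fun m t => ?_⟩
  · rw [norm_div, hnorm, div_self (norm_ne_zero_iff.mpr hu0)]
  · have h := Complex.mul_conj_eq_of_norm_eq ((hcont j).sub (hcont i)) ((hcont m).sub (hcont i))
      (hnorm j i) (hnorm m i) (fun t => by simpa using hnorm m j t) t
    have hc : conj (P j 0 - P i 0) ≠ 0 := (map_ne_zero _).mpr hu0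
    have hn : (P j t - P i t) * conj (P j t - P i t) =
        (P j 0 - P i 0) * conj (P j 0 - P i 0) := by
      rw [mul_conj', mul_conj', hnorm]
    have key : (P m t - P i t) * (P j 0 - P i 0) = (P m 0 - P i 0) * (P j t - P i t) := by
      apply mul_right_cancel₀ hc
      simp only [Pi.sub_apply] at h
      linear_combination (P j t - P i t) * h - (P m t - P i t) * hn
    rw [← mul_div_assoc, ← key, mul_div_cancel_right₀ _ hu0]
    ring

open ComplexConjugate in
/-- A complex number is recovered from its cross products with two independent vectors. -/
theorem Complex.cross_smul_eq (a b x : ℂ) :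
    ((conj a * b).im : ℂ) * x = ((conj a * x).im : ℂ) * b - ((conj b * x).im : ℂ) * a := by
  apply Complex.ext <;> simp <;> ring

open ComplexConjugate in
/-- If `g * (z - 1)` is real for two distinct `z ≠ 1` on the unit circle, then `g = 0`. -/
theorem Complex.eq_zero_of_im_mul_sub_one_eq_zero {g z w : ℂ} (hz : ‖z‖ = 1) (hw : ‖w‖ = 1)
    (hz1 : z ≠ 1) (hw1 : w ≠ 1) (hzw : z ≠ w)
    (hgz : (g * (z - 1)).im = 0) (hgw : (g * (w - 1)).im = 0) : g = 0 := by
  have aux {z : ℂ} (hz : ‖z‖ = 1) (hz1 : z ≠ 1) (h : (g * (z - 1)).im = 0) :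
      g * z = -conj g := by
    have h1 : conj g * (conj z - 1) = g * (z - 1) := by
      simpa using conj_eq_iff_im.mpr h
    have h2 : z * conj z = 1 := by rw [mul_conj', hz]; simp
    apply mul_right_cancel₀ (sub_ne_zero.mpr hz1)
    linear_combination -z * h1 + conj g * h2
  have h : g * (z - w) = 0 := by
    rw [mul_sub, aux hz hz1 hgz, aux hw hw1 hgw, sub_self]
  exact (mul_eq_zero.mp h).resolve_right (sub_ne_zero.mpr hzw)

open ComplexConjugate in
/-- The concyclicity theorem in the complex plane: a nonconstant continuous rigid motion, each
point `P m` moving along a line with direction `D m`, not all these lines being parallel. -/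
theorem Complex.concyclic_of_rigid_motion {ι : Type*} {P : ι → ℝ → ℂ} {D : ι → ℂ}
    (hcont : ∀ i, Continuous (P i))
    (hrigid : ∀ i j t, dist (P i t) (P j t) = dist (P i 0) (P j 0))
    (hD : ∀ i, D i ≠ 0) (hline : ∀ i t, (conj (D i) * (P i t - P i 0)).im = 0)
    {i j : ι} (hij : P i 0 ≠ P j 0) {a b : ι} (hab : (conj (D a) * D b).im ≠ 0)
    (hmove : ∃ i t, P i t ≠ P i 0) (t : ℝ) :
    ∃ (c : ℂ) (r : ℝ), ∀ m, dist (P m t) c = r := by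
  obtain ⟨z, hz, hz0, hz1, hP⟩ := Complex.exists_rotation_of_dist_eq hcont hrigid hij
  have hκ : ((conj (D a) * D b).im : ℂ) ≠ 0 := ofReal_ne_zero.mpr hab
  have hdisp (m t) : P m t - P m 0 = (P i t - P i 0) + (P m 0 - P i 0) * (z t - 1) := by
    rw [hP m t]; ring
  have him (m t) : (conj (D m) * (P i t - P i 0)).im =
      -(conj (D m) * (P m 0 - P i 0) * (z t - 1)).im := by
    have h := hline m t
    rw [hdisp, mul_add, add_im, ← mul_assoc] at h
    linarith
  obtain ⟨μ, ν, hμν⟩ : ∃ μ ν : ℂ, ∀ t, P i t - P i 0 = μ * (z t - 1) + ν * conj (z t - 1) := by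
    have him' (y : ℂ) : (y.im : ℂ) = (y - conj y) * (-I / 2) := by
      apply Complex.ext
      · simp; ring
      · simp
    refine ⟨(-(conj (D a) * (P a 0 - P i 0)) * D b + conj (D b) * (P b 0 - P i 0) * D a) *
        (-I / 2) / ((conj (D a) * D b).im : ℂ),
      (D a * conj (P a 0 - P i 0) * D b - D b * conj (P b 0 - P i 0) * D a) *
        (-I / 2) / ((conj (D a) * D b).im : ℂ), fun t => ?_⟩
    have h := Complex.cross_smul_eq (D a) (D b) (P i t - P i 0)
    rw [him a, him b, ofReal_neg, ofReal_neg, him' (_ * (z t - 1)), him' (_ * (z t - 1))] at h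
    simp only [map_mul, conj_conj] at h
    generalize ((conj (D a) * D b).im : ℂ) = κ at h hκ ⊢
    apply mul_left_cancel₀ hκ
    rw [h]
    field_simp
    ring
  have hnc : ∃ s, z s ≠ 1 := by
    by_contra! hc
    obtain ⟨m, s, hms⟩ := hmove
    refine hms (sub_eq_zero.mp ?_)
    rw [hdisp, hμν, hc]
    simp
  obtain ⟨s, hs⟩ := hnc
  obtain ⟨s', hs'1, hs's⟩ : ∃ s', z s' ≠ 1 ∧ z s ≠ z s' := by
    have hinf := (isPreconnected_range hz).infinite_of_nontrivial
      ⟨z s, ⟨s, rfl⟩, z 0, ⟨0, rfl⟩, by rwa [hz0]⟩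
    by_contra! hc
    refine hinf ((Set.toFinite {1, z s}).subset ?_)
    rintro _ ⟨r, rfl⟩
    by_cases hr : z r = 1
    · exact Or.inl hr
    · exact Or.inr (hc r hr).symm
  refine ⟨P i t - μ * z t, ‖ν‖, fun m => ?_⟩
  have hg (t) : ((conj (D m) * (μ + (P m 0 - P i 0)) - D m * conj ν) * (z t - 1)).im = 0 := by
    have h := hline m t
    rw [hdisp, hμν] at h
    have h' : (conj (D m) * (ν * conj (z t - 1))).im = -(D m * conj ν * (z t - 1)).im := by
      rw [← conj_im]
      simp [mul_assoc]
    rw [show conj (D m) * (μ * (z t - 1) + ν * conj (z t - 1) + (P m 0 - P i 0) * (z t - 1)) =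
      conj (D m) * (μ + (P m 0 - P i 0)) * (z t - 1) + conj (D m) * (ν * conj (z t - 1)) by ring,
      add_im, h'] at h
    rw [sub_mul, sub_im]
    linarith
  have hG := sub_eq_zero.mp (Complex.eq_zero_of_im_mul_sub_one_eq_zero (hz1 s) (hz1 s') hs hs'1
    hs's (hg s) (hg s'))
  have hN := congrArg norm hG
  rw [norm_mul, norm_mul, norm_conj, norm_conj] at hN
  rw [dist_eq_norm, hP m t, ← mul_left_cancel₀ (norm_ne_zero_iff.mpr (hD m)) hN,
    show P i t + (P m 0 - P i 0) * z t - (P i t - μ * z t) = (μ + (P m 0 - P i 0)) * z t by ring,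
    norm_mul, hz1, mul_one]

open ComplexConjugate in
/-- Two nonzero complex numbers with vanishing cross product span the same real line. -/
theorem Complex.span_singleton_eq_of_im_eq_zero {a b : ℂ} (ha : a ≠ 0) (hb : b ≠ 0)
    (h : (conj a * b).im = 0) : Submodule.span ℝ {a} = Submodule.span ℝ {b} := by
  have hb' : b = ((conj a * b).re / normSq a) • a := by
    have h1 : conj a * b = ((conj a * b).re : ℂ) := Complex.ext rfl (by simpa using h)
    have h2 : (normSq a : ℂ) ≠ 0 := ofReal_ne_zero.mpr (normSq_eq_zero.not.mpr ha)
    rw [real_smul, ofReal_div, ← h1]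
    field_simp
    rw [← mul_conj]
    ring
  have hr : (conj a * b).re / normSq a ≠ 0 := by
    intro h0
    rw [h0, zero_smul] at hb'
    exact hb hb'
  rw [hb', Submodule.span_singleton_smul_eq (isUnit_iff_ne_zero.mpr hr)]

theorem rigid_polygon_motion_concyclic {k : ℕ} (hk : 3 ≤ k)
    (L : Fin k → AffineSubspace ℝ (EuclideanSpace ℝ (Fin 2)))
    (hL : ∀ i, IsAffineLine (L i))
    (p : Fin k → ℝ → EuclideanSpace ℝ (Fin 2))
    (hcont : ∀ i, Continuous (p i))
    (hmem : ∀ i t, p i t ∈ L i)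
    (hrigid : ∀ i j t, dist (p i t) (p j t) = dist (p i 0) (p j 0))
    (hncol : ¬ Collinear ℝ (Set.range fun i => p i 0))
    (hmove : ∃ i t, p i t ≠ p i 0) :
    (∀ i j, (L i).direction = (L j).direction) ∨
      (∀ t : ℝ, ∃ (c : EuclideanSpace ℝ (Fin 2)) (r : ℝ), ∀ i, dist (p i t) c = r) := by
  let e : ℂ ≃ₗᵢ[ℝ] EuclideanSpace ℝ (Fin 2) := Complex.orthonormalBasisOneI.repr
  have hdir (i) : ∃ d : ℂ, d ≠ 0 ∧ (L i).direction = Submodule.span ℝ {e d} := by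
    obtain ⟨v, hv0, hv⟩ := finrank_eq_one_iff'.mp (hL i).2
    refine ⟨e.symm v, by simpa using hv0, le_antisymm (fun w hw => ?_) ?_⟩
    · obtain ⟨c, hc⟩ := hv ⟨w, hw⟩
      exact Submodule.mem_span_singleton.mpr ⟨c, by simpa using congrArg Subtype.val hc⟩
    · simp
  choose D hD hLD using hdir
  rw [or_iff_not_imp_left]
  intro hpar t
  obtain ⟨i, j, hij⟩ : ∃ i j, p i 0 ≠ p j 0 := by
    by_contra! hc
    apply hncol
    have hs : (Set.range fun i => p i 0).Subsingleton := by
      rintro _ ⟨i, rfl⟩ _ ⟨j, rfl⟩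
      exact hc i j
    rcases hs.eq_empty_or_singleton with h | ⟨x, h⟩
    · rw [h]; exact collinear_empty ℝ _
    · rw [h]; exact collinear_singleton ℝ x
  obtain ⟨a, b, hab⟩ : ∃ a b, (starRingEnd ℂ (D a) * D b).im ≠ 0 := by
    by_contra! hc
    refine hpar fun a b => ?_
    have h := congrArg (Submodule.map e.toLinearEquiv.toLinearMap)
      (Complex.span_singleton_eq_of_im_eq_zero (hD a) (hD b) (hc a b))
    rw [hLD, hLD]
    simpa [Submodule.map_span] using h
  have hline (i t) : (starRingEnd ℂ (D i) * (e.symm (p i t) - e.symm (p i 0))).im = 0 := by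
    have h : p i t - p i 0 ∈ (L i).direction :=
      AffineSubspace.vsub_mem_direction (hmem i t) (hmem i 0)
    rw [hLD, Submodule.mem_span_singleton] at h
    obtain ⟨c, hc⟩ := h
    rw [← map_sub, ← hc, map_smul, e.symm_apply_apply]
    simp
    ring
  obtain ⟨c, r, h⟩ := Complex.concyclic_of_rigid_motion (P := fun i t => e.symm (p i t)) (D := D)
    (fun i => e.symm.continuous.comp (hcont i))
    (fun i j t => by simpa only [e.symm.dist_map] using hrigid i j t) hD hline
    (i := i) (j := j) (fun h => hij (e.symm.injective h)) hab
    (hmove.imp fun i => Exists.imp fun t h h' => h (e.symm.injective h')) t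
  exact ⟨e c, r, fun m => by rw [← h m, ← e.dist_map, e.apply_symm_apply]⟩
end

section
/- Let L₁, L₂, L₃ be affine lines in the Euclidean plane ℝ² passing through a common point p₀ and having pairwise distinct directions. Then there exist continuous maps p₁, p₂, p₃ : ℝ → ℝ² such that pᵢ(θ) ∈ Lᵢ for all θ and all i, each pairwise distance dist(pᵢ(θ), pⱼ(θ)) is constant in θ and positive, the points p₁(θ), p₂(θ), p₃(θ) are not collinear for every θ, and the motion is nonconstant (there exist i and θ with pᵢ(θ) ≠ pᵢ(0)). -/
/-- The direction of an affine line in the plane is spanned by a unit vector. -/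
theorem IsAffineLine.exists_unit_direction {L : AffineSubspace ℝ (EuclideanSpace ℝ (Fin 2))}
    (hL : IsAffineLine L) :
    ∃ u : EuclideanSpace ℝ (Fin 2), u 0 ^ 2 + u 1 ^ 2 = 1 ∧ L.direction = ℝ ∙ u := by
  obtain ⟨⟨v, hvL⟩, hv, hspan⟩ := finrank_eq_one_iff'.1 hL.2
  have hv0 : v ≠ 0 := by simpa using hv
  have hn : ‖v‖ ≠ 0 := norm_ne_zero_iff.2 hv0
  refine ⟨‖v‖⁻¹ • v, ?_, ?_⟩
  · have h := EuclideanSpace.real_norm_sq_eq (‖v‖⁻¹ • v)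
    rw [norm_smul, norm_inv, norm_norm, inv_mul_cancel₀ hn] at h
    simpa [Fin.sum_univ_two] using h.symm
  · rw [Submodule.span_singleton_smul_eq (IsUnit.mk0 _ (inv_ne_zero hn))]
    apply le_antisymm
    · intro w hw
      obtain ⟨c, hc⟩ := hspan ⟨w, hw⟩
      exact Submodule.mem_span_singleton.2 ⟨c, congrArg Subtype.val hc⟩
    · exact (Submodule.span_singleton_le_iff_mem _ _).2 hvL

/-- Unit vectors of the plane with vanishing determinant span the same line. -/
theorem span_singleton_eq_of_det_eq_zero {u v : EuclideanSpace ℝ (Fin 2)}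
    (hu : u 0 ^ 2 + u 1 ^ 2 = 1) (hv : v 0 ^ 2 + v 1 ^ 2 = 1)
    (h : u 0 * v 1 - u 1 * v 0 = 0) : ℝ ∙ u = ℝ ∙ v := by
  apply le_antisymm <;> rw [Submodule.span_singleton_le_iff_mem, Submodule.mem_span_singleton] <;>
    refine ⟨u 0 * v 0 + u 1 * v 1, ?_⟩ <;> ext i <;> fin_cases i <;> simp
  · linear_combination u 0 * hv - v 1 * h
  · linear_combination u 1 * hv + v 0 * h
  · linear_combination v 0 * hu + u 1 * h
  · linear_combination v 1 * hu - u 0 * h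

/-- The determinant of the edge vectors of a collinear triple in the plane vanishes. -/
theorem Collinear.det_eq_zero {x y z : EuclideanSpace ℝ (Fin 2)}
    (h : Collinear ℝ ({x, y, z} : Set (EuclideanSpace ℝ (Fin 2)))) :
    (y 0 - x 0) * (z 1 - x 1) - (y 1 - x 1) * (z 0 - x 0) = 0 := by
  obtain ⟨q, v, hq⟩ := (collinear_iff_exists_forall_eq_smul_vadd _).1 h
  obtain ⟨r, rfl⟩ := hq x (by simp)
  obtain ⟨s, rfl⟩ := hq y (by simp)
  obtain ⟨t, rfl⟩ := hq z (by simp)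
  simp
  ring

/-- The point where the line through `q` with unit direction `u` meets again the circle with
diameter from `q` to `q + (cos θ, sin θ)`. -/
noncomputable def circleTrace (q u : EuclideanSpace ℝ (Fin 2)) (θ : ℝ) :
    EuclideanSpace ℝ (Fin 2) :=
  q + (Real.cos θ * u 0 + Real.sin θ * u 1) • u

theorem continuous_circleTrace (q u : EuclideanSpace ℝ (Fin 2)) :
    Continuous (circleTrace q u) := by
  unfold circleTrace
  fun_prop

theorem circleTrace_apply (q u : EuclideanSpace ℝ (Fin 2)) (θ : ℝ) (i : Fin 2) :
    circleTrace q u θ i = q i + (Real.cos θ * u 0 + Real.sin θ * u 1) * u i := by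
  simp [circleTrace]

/-- The edges of a triangle inscribed in a circle of diameter one, by the law of sines. -/
theorem sq_edge_inscribed {s c a b a₂ b₂ : ℝ} (h : s ^ 2 + c ^ 2 = 1) (hu : a ^ 2 + b ^ 2 = 1)
    (hv : a₂ ^ 2 + b₂ ^ 2 = 1) (x y : ℝ) :
    (x + (c * a + s * b) * a - (x + (c * a₂ + s * b₂) * a₂)) ^ 2 +
      (y + (c * a + s * b) * b - (y + (c * a₂ + s * b₂) * b₂)) ^ 2 = (a * b₂ - b * a₂) ^ 2 := by
  grind

/-- Twice the signed area of a triangle inscribed in a circle of diameter one, by the sines of its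
angles. -/
theorem det_edges_inscribed {s c a b a₂ b₂ a₃ b₃ : ℝ} (h : s ^ 2 + c ^ 2 = 1) (hu : a ^ 2 + b ^ 2 = 1)
    (hv : a₂ ^ 2 + b₂ ^ 2 = 1) (hw : a₃ ^ 2 + b₃ ^ 2 = 1) (x y : ℝ) :
    (x + (c * a₂ + s * b₂) * a₂ - (x + (c * a + s * b) * a)) *
      (y + (c * a₃ + s * b₃) * b₃ - (y + (c * a + s * b) * b)) -
    (y + (c * a₂ + s * b₂) * b₂ - (y + (c * a + s * b) * b)) *
      (x + (c * a₃ + s * b₃) * a₃ - (x + (c * a + s * b) * a)) =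
    (a * b₂ - b * a₂) * (a₂ * b₃ - b₂ * a₃) * (a * b₃ - b * a₃) := by
  grind

theorem dist_circleTrace (q : EuclideanSpace ℝ (Fin 2)) {u v : EuclideanSpace ℝ (Fin 2)}
    (hu : u 0 ^ 2 + u 1 ^ 2 = 1) (hv : v 0 ^ 2 + v 1 ^ 2 = 1) (θ : ℝ) :
    dist (circleTrace q u θ) (circleTrace q v θ) = |u 0 * v 1 - u 1 * v 0| := by
  rw [EuclideanSpace.dist_eq, ← Real.sqrt_sq_eq_abs]
  congr 1
  simp only [Fin.sum_univ_two, Real.dist_eq, sq_abs, circleTrace_apply]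
  exact sq_edge_inscribed (Real.sin_sq_add_cos_sq θ) hu hv _ _

theorem det_circleTrace (q : EuclideanSpace ℝ (Fin 2)) {u v w : EuclideanSpace ℝ (Fin 2)}
    (hu : u 0 ^ 2 + u 1 ^ 2 = 1) (hv : v 0 ^ 2 + v 1 ^ 2 = 1) (hw : w 0 ^ 2 + w 1 ^ 2 = 1)
    (θ : ℝ) :
    (circleTrace q v θ 0 - circleTrace q u θ 0) * (circleTrace q w θ 1 - circleTrace q u θ 1) -
      (circleTrace q v θ 1 - circleTrace q u θ 1) * (circleTrace q w θ 0 - circleTrace q u θ 0) =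
    (u 0 * v 1 - u 1 * v 0) * (v 0 * w 1 - v 1 * w 0) * (u 0 * w 1 - u 1 * w 0) := by
  simp only [circleTrace_apply]
  exact det_edges_inscribed (Real.sin_sq_add_cos_sq θ) hu hv hw _ _

theorem exists_hypocycloid_motion
    (L : Fin 3 → AffineSubspace ℝ (EuclideanSpace ℝ (Fin 2)))
    (hL : ∀ i, IsAffineLine (L i))
    (p₀ : EuclideanSpace ℝ (Fin 2))
    (hp₀ : ∀ i, p₀ ∈ L i)
    (hdistinct : ∀ i j, i ≠ j → (L i).direction ≠ (L j).direction) :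
    ∃ p : Fin 3 → ℝ → EuclideanSpace ℝ (Fin 2),
      (∀ i, Continuous (p i)) ∧
      (∀ i θ, p i θ ∈ L i) ∧
      (∀ i j θ, dist (p i θ) (p j θ) = dist (p i 0) (p j 0)) ∧
      (∀ i j, i ≠ j → 0 < dist (p i 0) (p j 0)) ∧
      (∀ θ, ¬ Collinear ℝ ({p 0 θ, p 1 θ, p 2 θ} : Set (EuclideanSpace ℝ (Fin 2)))) ∧
      (∃ i θ, p i θ ≠ p i 0) := by
  choose u hu hdir using fun i => (hL i).exists_unit_direction
  have hdet : ∀ i j, i ≠ j → u i 0 * u j 1 - u i 1 * u j 0 ≠ 0 := fun i j hij h =>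
    hdistinct i j hij <| by
      rw [hdir, hdir, span_singleton_eq_of_det_eq_zero (hu i) (hu j) h]
  refine ⟨fun i => circleTrace p₀ (u i), fun i => continuous_circleTrace _ _, fun i θ => ?_,
    fun i j θ => ?_, fun i j hij => ?_, fun θ hcol => ?_, ?_⟩
  · change p₀ + _ ∈ L i
    rw [add_comm]
    refine AffineSubspace.vadd_mem_of_mem_direction ?_ (hp₀ i)
    rw [hdir]
    exact Submodule.smul_mem _ _ (Submodule.mem_span_singleton_self _)
  · rw [dist_circleTrace _ (hu i) (hu j), dist_circleTrace _ (hu i) (hu j)]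
  · rw [dist_circleTrace _ (hu i) (hu j)]
    exact abs_pos.2 (hdet i j hij)
  · have h := hcol.det_eq_zero
    rw [det_circleTrace _ (hu 0) (hu 1) (hu 2)] at h
    exact mul_ne_zero (mul_ne_zero (hdet 0 1 (by decide)) (hdet 1 2 (by decide)))
      (hdet 0 2 (by decide)) h
  · by_contra! h
    have hu0 : u 0 ≠ 0 := by
      intro h0
      simpa [h0] using hu 0
    have hπ := h 0 Real.pi
    have hπ2 := h 0 (Real.pi / 2)
    simp only [circleTrace, add_right_inj, smul_left_inj hu0, Real.cos_pi, Real.sin_pi,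
      Real.cos_zero, Real.sin_zero, Real.cos_pi_div_two, Real.sin_pi_div_two] at hπ hπ2
    have h0 : u 0 0 = 0 := by linarith
    have h1 : u 0 1 = 0 := by linarith
    simpa [h0, h1] using hu 0
end
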